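/- arXiv:2405.03249 — 2 statements merged into one kernel-verified Lean document; each statement's English description precedes it below -/
import Mathlib

section
/- Let f = (f11,f12,f22) be a symmetric 2-tensor field with C² components compactly supported in the open unit disk, and assume u1 ≠ u2. Then for every x ∈ ℝ², f11(x) = (1/(2·(u2² - u1²)))·[ D_u D_v (L¹f)(x) + D_u(Lf)(x) + D_v(Lf)(x) + u2·D_u D_v X_{e2}(Lf + Tf)(x) ]. -/
open MeasureTheory

noncomputable section

/-- Rotation of a vector by 90 degrees: `w⊥ = (-w2, w1)`. -/
def perp (w : ℝ × ℝ) : ℝ × ℝ := (-w.2, w.1)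

/-- Divergent beam transform `X_w h (x) = ∫_0^∞ h(x + t w) dt`. -/
def Xray (w : ℝ × ℝ) (h : ℝ × ℝ → ℝ) (x : ℝ × ℝ) : ℝ :=
  ∫ t in Set.Ioi (0:ℝ), h (x + t • w)

/-- First moment divergent beam transform `X¹_w h (x) = ∫_0^∞ t·h(x + t w) dt`. -/
def Xray1 (w : ℝ × ℝ) (h : ℝ × ℝ → ℝ) (x : ℝ × ℝ) : ℝ :=
  ∫ t in Set.Ioi (0:ℝ), t * h (x + t • w)

/-- Directional derivative `D_w h = w1 ∂h/∂x1 + w2 ∂h/∂x2`. -/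
def Dw (w : ℝ × ℝ) (h : ℝ × ℝ → ℝ) (x : ℝ × ℝ) : ℝ :=
  fderiv ℝ h x w

/-- Partial derivative in the first coordinate. -/
def pdx (h : ℝ × ℝ → ℝ) : ℝ × ℝ → ℝ := Dw (1, 0) h

/-- Partial derivative in the second coordinate. -/
def pdy (h : ℝ × ℝ → ℝ) : ℝ × ℝ → ℝ := Dw (0, 1) h

/-- The open unit disk in ℝ². -/
def unitDisk : Set (ℝ × ℝ) := {x | x.1 ^ 2 + x.2 ^ 2 < 1}

/-- `⟨f, w²⟩ = f11 w1² + 2 f12 w1 w2 + f22 w2²`. -/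
def proj2 (f11 f12 f22 : ℝ × ℝ → ℝ) (w : ℝ × ℝ) (x : ℝ × ℝ) : ℝ :=
  f11 x * w.1 ^ 2 + 2 * f12 x * w.1 * w.2 + f22 x * w.2 ^ 2

/-- `⟨f, w ⊙ w⊥⟩ = -f11 w1 w2 + f12 (w1² - w2²) + f22 w1 w2`. -/
def projMix (f11 f12 f22 : ℝ × ℝ → ℝ) (w : ℝ × ℝ) (x : ℝ × ℝ) : ℝ :=
  -(f11 x) * w.1 * w.2 + f12 x * (w.1 ^ 2 - w.2 ^ 2) + f22 x * w.1 * w.2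

/-- V-line transform of a scalar function. -/
def Vlt (u v : ℝ × ℝ) (h : ℝ × ℝ → ℝ) (x : ℝ × ℝ) : ℝ := Xray u h x + Xray v h x

/-- Longitudinal V-line transform. -/
def Lf (u v : ℝ × ℝ) (f11 f12 f22 : ℝ × ℝ → ℝ) (x : ℝ × ℝ) : ℝ :=
  Xray u (proj2 f11 f12 f22 u) x + Xray v (proj2 f11 f12 f22 v) x

/-- Transverse V-line transform. -/
def Tf (u v : ℝ × ℝ) (f11 f12 f22 : ℝ × ℝ → ℝ) (x : ℝ × ℝ) : ℝ :=
  Xray u (proj2 f11 f12 f22 (perp u)) x + Xray v (proj2 f11 f12 f22 (perp v)) x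

/-- Mixed V-line transform. -/
def Mf (u v : ℝ × ℝ) (f11 f12 f22 : ℝ × ℝ → ℝ) (x : ℝ × ℝ) : ℝ :=
  Xray u (projMix f11 f12 f22 u) x + Xray v (projMix f11 f12 f22 v) x

/-- First moment longitudinal V-line transform. -/
def L1f (u v : ℝ × ℝ) (f11 f12 f22 : ℝ × ℝ → ℝ) (x : ℝ × ℝ) : ℝ :=
  Xray1 u (proj2 f11 f12 f22 u) x + Xray1 v (proj2 f11 f12 f22 v) x

/-- The function `h` vanishes on the open half plane `{y | 1 < y.2}`. -/
def VanishesAbove {E : Type*} [Zero E] (h : ℝ × ℝ → E) : Prop := ∀ y, 1 < y.2 → h y = 0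

/-- The divergent beam transform with weight `k` of a vector-valued function. -/
def rayIntegral {E : Type*} [NormedAddCommGroup E] [NormedSpace ℝ E] (k : ℝ → ℝ) (w : ℝ × ℝ)
    (h : ℝ × ℝ → E) (x : ℝ × ℝ) : E :=
  ∫ t in Set.Ioi (0 : ℝ), k t • h (x + t • w)

section RayIntegral

open Set Filter Topology

variable {E : Type*} [NormedAddCommGroup E] [NormedSpace ℝ E]

lemma Xray_eq_rayIntegral (w : ℝ × ℝ) (h : ℝ × ℝ → ℝ) :
    Xray w h = rayIntegral (fun _ => 1) w h := by
  funext x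
  simp [Xray, rayIntegral]

lemma Xray1_eq_rayIntegral (w : ℝ × ℝ) (h : ℝ × ℝ → ℝ) :
    Xray1 w h = rayIntegral (fun t => t) w h := by
  funext x
  simp [Xray1, rayIntegral]

lemma integral_Ioi_zero_eq_intervalIntegral {F : ℝ → E} {R : ℝ} (hR : 0 ≤ R)
    (hF : ∀ t, R < t → F t = 0) : ∫ t in Ioi (0 : ℝ), F t = ∫ t in (0 : ℝ)..R, F t := by
  rw [intervalIntegral.integral_of_le hR]
  refine (setIntegral_eq_of_subset_of_forall_sdiff_eq_zero measurableSet_Ioi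
    Ioc_subset_Ioi_self ?_)
  rintro t ⟨ht0, htR⟩
  exact hF t (not_le.1 fun h => htR ⟨ht0, h⟩)

lemma integrableOn_Ioi_zero_of_continuous {E : Type*} [NormedAddCommGroup E] {F : ℝ → E} {R : ℝ}
    (hc : Continuous F) (hF : ∀ t, R < t → F t = 0) : IntegrableOn F (Ioi (0 : ℝ)) := by
  refine IntegrableOn.of_forall_sdiff_eq_zero (s := Icc 0 R)
    hc.integrableOn_Icc measurableSet_Ioi ?_
  rintro t ⟨ht0, htR⟩
  exact hF t (not_le.1 fun h => htR ⟨le_of_lt ht0, h⟩)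

namespace VanishesAbove

variable {h : ℝ × ℝ → E} {k : ℝ → ℝ} {w : ℝ × ℝ}

lemma fderiv (hv : VanishesAbove h) : VanishesAbove (fderiv ℝ h) := by
  intro y hy
  have : h =ᶠ[𝓝 y] fun _ => 0 := by
    filter_upwards [(isOpen_lt continuous_const continuous_snd).mem_nhds hy] with z hz
    exact hv z hz
  rw [this.fderiv_eq, fderiv_const_apply]

lemma dw {h : ℝ × ℝ → ℝ} (hv : VanishesAbove h) (z : ℝ × ℝ) : VanishesAbove (Dw z h) := by
  intro y hy
  simp [Dw, hv.fderiv y hy]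

lemma add_smul_eq_zero {E : Type*} [Zero E] {h : ℝ × ℝ → E} (hv : VanishesAbove h)
    (hw : 0 < w.2) {x : ℝ × ℝ} {t : ℝ} (ht : (1 - x.2) / w.2 < t) : h (x + t • w) = 0 := by
  apply hv
  rw [div_lt_iff₀ hw] at ht
  simp only [Prod.snd_add, Prod.smul_snd, smul_eq_mul]
  linarith

lemma rayIntegral (hv : VanishesAbove h) (hw : 0 < w.2) : VanishesAbove (rayIntegral k w h) := by
  intro y hy
  refine setIntegral_eq_zero_of_forall_eq_zero fun t ht => ?_
  rw [hv.add_smul_eq_zero hw, smul_zero]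
  exact (div_neg_of_neg_of_pos (by linarith) hw).trans ht

/-- Near `x`, the ray integral is an integral over a fixed bounded interval. -/
lemma rayIntegral_eventuallyEq (hv : VanishesAbove h) (hw : 0 < w.2) (k : ℝ → ℝ)
    (x : ℝ × ℝ) : _root_.rayIntegral k w h =ᶠ[𝓝 x]
      fun y => ∫ t in (0 : ℝ)..max 0 ((2 - x.2) / w.2), k t • h (y + t • w) := by
  have hx : {y : ℝ × ℝ | x.2 - 1 < y.2} ∈ 𝓝 x :=
    (isOpen_lt continuous_const continuous_snd).mem_nhds (by simp)
  filter_upwards [hx] with y hy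
  refine integral_Ioi_zero_eq_intervalIntegral (le_max_left _ _) fun t ht => ?_
  rw [hv.add_smul_eq_zero hw, smul_zero]
  refine lt_of_le_of_lt ?_ ((le_max_right _ _).trans_lt ht)
  have : x.2 - 1 < y.2 := hy
  exact div_le_div_of_nonneg_right (by linarith) hw.le

lemma integrableOn (hv : VanishesAbove h) (hw : 0 < w.2) (hk : Continuous k)
    (hc : Continuous h) (x : ℝ × ℝ) :
    IntegrableOn (fun t => k t • h (x + t • w)) (Ioi (0 : ℝ)) :=
  integrableOn_Ioi_zero_of_continuous (R := (1 - x.2) / w.2) (by fun_prop) fun t ht => by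
    rw [hv.add_smul_eq_zero hw ht, smul_zero]

lemma continuous_rayIntegral (hv : VanishesAbove h) (hw : 0 < w.2) (hk : Continuous k)
    (hc : Continuous h) : Continuous (_root_.rayIntegral k w h) := by
  refine continuous_iff_continuousAt.2 fun x => ?_
  refine ContinuousAt.congr (Continuous.continuousAt ?_) (hv.rayIntegral_eventuallyEq hw k x).symm
  exact intervalIntegral.continuous_parametric_intervalIntegral_of_continuous' (by fun_prop) 0 _

/-- Differentiation under the integral sign for ray integrals. -/
lemma hasFDerivAt_rayIntegral (hv : VanishesAbove h) (hw : 0 < w.2) (hk : Continuous k)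
    (hc : ContDiff ℝ 1 h) (x : ℝ × ℝ) :
    HasFDerivAt (_root_.rayIntegral k w h) (_root_.rayIntegral k w (_root_.fderiv ℝ h) x) x := by
  have hcf : Continuous (_root_.fderiv ℝ h) := hc.continuous_fderiv one_ne_zero
  have hch : Continuous h := hc.continuous
  refine HasFDerivAt.congr_of_eventuallyEq ?_ (hv.rayIntegral_eventuallyEq hw k x)
  rw [(hv.fderiv.rayIntegral_eventuallyEq hw k x).eq_of_nhds]
  obtain ⟨C, hC⟩ := ((isCompact_closedBall x 1).prod
    (isCompact_uIcc (a := 0) (b := max 0 ((2 - x.2) / w.2)))).exists_bound_of_continuousOn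
    (f := fun p : (ℝ × ℝ) × ℝ => k p.2 • _root_.fderiv ℝ h (p.1 + p.2 • w)) (by fun_prop)
  refine intervalIntegral.hasFDerivAt_integral_of_dominated_of_fderiv_le (𝕜 := ℝ)
    (F' := fun y t => k t • _root_.fderiv ℝ h (y + t • w)) (bound := fun _ => C)
    (Metric.closedBall_mem_nhds x one_pos)
    (Eventually.of_forall fun y => Continuous.aestronglyMeasurable (by fun_prop))
    (Continuous.intervalIntegrable (by fun_prop) _ _)
    (Continuous.aestronglyMeasurable (by fun_prop))
    (ae_of_all _ fun t ht y hy => hC (y, t) ⟨hy, uIoc_subset_uIcc ht⟩)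
    intervalIntegrable_const (ae_of_all _ fun t _ y _ => ?_)
  exact ((hasFDerivAt_comp_add_right (t • w)).2
    (hc.differentiable one_ne_zero _).hasFDerivAt).const_smul (k t)

lemma contDiff_rayIntegral (hv : VanishesAbove h) (hw : 0 < w.2) (hk : Continuous k)
    (hc : ContDiff ℝ 1 h) : ContDiff ℝ 1 (_root_.rayIntegral k w h) := by
  refine contDiff_one_iff_fderiv.2
    ⟨fun x => (hv.hasFDerivAt_rayIntegral hw hk hc x).differentiableAt, ?_⟩
  rw [funext fun x => (hv.hasFDerivAt_rayIntegral hw hk hc x).fderiv]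
  exact hv.fderiv.continuous_rayIntegral hw hk (hc.continuous_fderiv one_ne_zero)

lemma dw_rayIntegral {h : ℝ × ℝ → ℝ} (hv : VanishesAbove h) (hw : 0 < w.2) (hk : Continuous k)
    (hc : ContDiff ℝ 1 h) (z : ℝ × ℝ) :
    Dw z (_root_.rayIntegral k w h) = _root_.rayIntegral k w (Dw z h) := by
  funext x
  rw [Dw, (hv.hasFDerivAt_rayIntegral hw hk hc x).fderiv, _root_.rayIntegral,
    ContinuousLinearMap.integral_apply
      (hv.fderiv.integrableOn hw hk (hc.continuous_fderiv one_ne_zero) x)]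
  rfl

/-- Integration by parts along the ray. -/
lemma rayIntegral_dw_self {h : ℝ × ℝ → ℝ} {k' : ℝ → ℝ} (hv : VanishesAbove h) (hw : 0 < w.2)
    (hk : ∀ t, HasDerivAt k (k' t) t) (hk' : Continuous k') (hc : ContDiff ℝ 1 h) (x : ℝ × ℝ) :
    _root_.rayIntegral k w (Dw w h) x = -(k 0 * h x) - _root_.rayIntegral k' w h x := by
  have hkc : Continuous k := continuous_iff_continuousAt.2 fun t => (hk t).continuousAt
  have hdc : Continuous (Dw w h) := (hc.continuous_fderiv one_ne_zero).clm_apply continuous_const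
  have hi := hv.integrableOn hw hk' hc.continuous x
  have hi' := (hv.dw w).integrableOn hw hkc hdc x
  have hd : ∀ t : ℝ, HasDerivAt (fun t => k t * h (x + t • w))
      (k' t • h (x + t • w) + k t • Dw w h (x + t • w)) t := by
    intro t
    have hline : HasDerivAt (fun t : ℝ => x + t • w) w t := by
      simpa using ((hasDerivAt_id t).smul_const w).const_add x
    exact (hk t).mul
      ((hc.differentiable one_ne_zero _).hasFDerivAt.comp_hasDerivAt t hline)
  have hlim : Tendsto (fun t => k t * h (x + t • w)) atTop (𝓝 0) := by
    refine tendsto_const_nhds.congr' ?_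
    filter_upwards [eventually_gt_atTop ((1 - x.2) / w.2)] with t ht
    rw [hv.add_smul_eq_zero hw ht, mul_zero]
  have := integral_Ioi_of_hasDerivAt_of_tendsto' (a := 0) (fun t _ => hd t) (hi.add hi') hlim
  rw [integral_add hi hi'] at this
  simp only [zero_smul, add_zero, zero_sub] at this
  rw [_root_.rayIntegral, _root_.rayIntegral]
  linarith

lemma xray {h : ℝ × ℝ → ℝ} (hv : VanishesAbove h) (hw : 0 < w.2) : VanishesAbove (Xray w h) :=
  Xray_eq_rayIntegral w h ▸ hv.rayIntegral hw

lemma contDiff_Xray {h : ℝ × ℝ → ℝ} (hv : VanishesAbove h) (hw : 0 < w.2)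
    (hc : ContDiff ℝ 1 h) : ContDiff ℝ 1 (Xray w h) :=
  Xray_eq_rayIntegral w h ▸ hv.contDiff_rayIntegral hw continuous_const hc

lemma contDiff_Xray1 {h : ℝ × ℝ → ℝ} (hv : VanishesAbove h) (hw : 0 < w.2)
    (hc : ContDiff ℝ 1 h) : ContDiff ℝ 1 (Xray1 w h) :=
  Xray1_eq_rayIntegral w h ▸ hv.contDiff_rayIntegral hw continuous_id hc

lemma dw_Xray {h : ℝ × ℝ → ℝ} (hv : VanishesAbove h) (hw : 0 < w.2)
    (hc : ContDiff ℝ 1 h) (z : ℝ × ℝ) : Dw z (Xray w h) = Xray w (Dw z h) := by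
  simp only [Xray_eq_rayIntegral, hv.dw_rayIntegral hw continuous_const hc]

lemma dw_Xray1 {h : ℝ × ℝ → ℝ} (hv : VanishesAbove h) (hw : 0 < w.2)
    (hc : ContDiff ℝ 1 h) (z : ℝ × ℝ) : Dw z (Xray1 w h) = Xray1 w (Dw z h) := by
  simp only [Xray1_eq_rayIntegral, hv.dw_rayIntegral hw continuous_id' hc]

lemma Xray_dw_self {h : ℝ × ℝ → ℝ} (hv : VanishesAbove h) (hw : 0 < w.2)
    (hc : ContDiff ℝ 1 h) : Xray w (Dw w h) = -h := by
  funext x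
  rw [Xray_eq_rayIntegral, hv.rayIntegral_dw_self hw (fun t => hasDerivAt_const t 1)
    continuous_const hc]
  simp [_root_.rayIntegral]

lemma Xray1_dw_self {h : ℝ × ℝ → ℝ} (hv : VanishesAbove h) (hw : 0 < w.2)
    (hc : ContDiff ℝ 1 h) : Xray1 w (Dw w h) = -Xray w h := by
  funext x
  rw [Xray1_eq_rayIntegral, hv.rayIntegral_dw_self hw (fun t => hasDerivAt_id' t)
    continuous_const hc, Xray_eq_rayIntegral]
  simp

lemma Xray_add {h g : ℝ × ℝ → ℝ} (hv : VanishesAbove h) (gv : VanishesAbove g) (hw : 0 < w.2)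
    (hc : Continuous h) (gc : Continuous g) :
    Xray w (h + g) = Xray w h + Xray w g := by
  funext x
  have hi := hv.integrableOn hw (k := fun _ => 1) continuous_const hc x
  have gi := gv.integrableOn hw (k := fun _ => 1) continuous_const gc x
  simp only [one_smul] at hi gi
  exact integral_add hi gi

end VanishesAbove

lemma Xray_const_smul (w : ℝ × ℝ) (c : ℝ) (h : ℝ × ℝ → ℝ) :
    Xray w (c • h) = c • Xray w h := by
  funext x
  exact integral_const_mul c _

end RayIntegral

lemma Dw_add {g h : ℝ × ℝ → ℝ} (hg : ContDiff ℝ 1 g) (hh : ContDiff ℝ 1 h) (z : ℝ × ℝ) :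
    Dw z (g + h) = Dw z g + Dw z h := by
  funext x
  simp [Dw, fderiv_add (hg.differentiable one_ne_zero x) (hh.differentiable one_ne_zero x)]

lemma Dw_neg (h : ℝ × ℝ → ℝ) (z : ℝ × ℝ) : Dw z (-h) = -Dw z h := by
  funext x
  simp [Dw, fderiv_neg]

lemma Dw_add_smul (c d : ℝ) (w z : ℝ × ℝ) (h : ℝ × ℝ → ℝ) :
    Dw (c • w + d • z) h = c • Dw w h + d • Dw z h := by
  funext x
  simp [Dw]

lemma contDiff_Dw {h : ℝ × ℝ → ℝ} (hc : ContDiff ℝ 2 h) (z : ℝ × ℝ) : ContDiff ℝ 1 (Dw z h) :=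
  (hc.fderiv_right (by norm_num)).clm_apply contDiff_const

/-- Opposite first-order terms cancel in the sum of the first-moment and the ordinary transforms. -/
lemma dw_dw_Xray1_add {u v : ℝ × ℝ} (hu : 0 < u.2) (hv : 0 < v.2) {a b : ℝ × ℝ → ℝ}
    (ha : ContDiff ℝ 2 a) (hb : ContDiff ℝ 2 b) (va : VanishesAbove a) (vb : VanishesAbove b) :
    Dw u (Dw v (Xray1 u a + Xray1 v b)) + Dw u (Xray u a + Xray v b)
      + Dw v (Xray u a + Xray v b) = -a - b := by
  have ha1 : ContDiff ℝ 1 a := ha.of_le one_le_two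
  have hb1 : ContDiff ℝ 1 b := hb.of_le one_le_two
  have hda := contDiff_Dw ha v
  rw [Dw_add (va.contDiff_Xray1 hu ha1) (vb.contDiff_Xray1 hv hb1), va.dw_Xray1 hu ha1,
    vb.dw_Xray1 hv hb1, vb.Xray1_dw_self hv hb1,
    Dw_add (h := -Xray v b) ((va.dw v).contDiff_Xray1 hu hda) (vb.contDiff_Xray hv hb1).neg,
    (va.dw v).dw_Xray1 hu hda, (va.dw v).Xray1_dw_self hu hda, Dw_neg, vb.dw_Xray hv hb1,
    Dw_add (va.contDiff_Xray hu ha1) (vb.contDiff_Xray hv hb1),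
    Dw_add (va.contDiff_Xray hu ha1) (vb.contDiff_Xray hv hb1),
    va.dw_Xray hu ha1, va.dw_Xray hu ha1, vb.dw_Xray hv hb1, vb.dw_Xray hv hb1,
    va.Xray_dw_self hu ha1, vb.Xray_dw_self hv hb1]
  abel

/-- Inversion of the scalar V-line transform whose axis `e` satisfies `u + v = c • e`. -/
lemma dw_dw_Xray_Vlt {u v e : ℝ × ℝ} {c : ℝ} (hu : 0 < u.2) (hv : 0 < v.2) (he : 0 < e.2)
    (huve : u + v = c • e) {g : ℝ × ℝ → ℝ} (hg : ContDiff ℝ 2 g) (vg : VanishesAbove g) :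
    Dw u (Dw v (Xray e (Vlt u v g))) = c • g := by
  have hg1 : ContDiff ℝ 1 g := hg.of_le one_le_two
  have hdg := contDiff_Dw hg v
  have hcu := vg.contDiff_Xray hu hg1
  have hcv := vg.contDiff_Xray hv hg1
  have hcd := (vg.dw v).contDiff_Xray hu hdg
  have hV : Vlt u v g = Xray u g + Xray v g := rfl
  have vV : VanishesAbove (Vlt u v g) := fun y hy => by
    simp [hV, vg.xray hu y hy, vg.xray hv y hy]
  have hDV : Dw v (Vlt u v g) = Xray u (Dw v g) + -g := by
    rw [hV, Dw_add hcu hcv, vg.dw_Xray hu hg1, vg.dw_Xray hv hg1, vg.Xray_dw_self hv hg1]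
  have hDDV : Dw u (Xray u (Dw v g) + -g) = (-c) • Dw e g := by
    have hsum : Dw u g + Dw v g = c • Dw e g := by
      simpa [huve] using (Dw_add_smul 1 1 u v g).symm.trans
        (by simpa [huve] using Dw_add_smul c 0 e e g)
    rw [Dw_add (h := -g) hcd hg1.neg, (vg.dw v).dw_Xray hu hdg, (vg.dw v).Xray_dw_self hu hdg, Dw_neg,
      neg_smul, ← hsum]
    abel
  rw [vV.dw_Xray he (hV ▸ hcu.add hcv), (vV.dw v).dw_Xray he (hDV ▸ hcd.add hg1.neg), hDV, hDDV,
    Xray_const_smul, vg.Xray_dw_self he hg1]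
  simp

lemma vanishesAbove_of_tsupport_subset {h : ℝ × ℝ → ℝ} (hs : tsupport h ⊆ unitDisk) :
    VanishesAbove h := by
  intro y hy
  by_contra hne
  have : y.1 ^ 2 + y.2 ^ 2 < 1 := hs (subset_tsupport h hne)
  nlinarith [sq_nonneg y.1]

section Proj2

variable {f11 f12 f22 : ℝ × ℝ → ℝ}

lemma contDiff_proj2 (hf11 : ContDiff ℝ 2 f11) (hf12 : ContDiff ℝ 2 f12)
    (hf22 : ContDiff ℝ 2 f22) (w : ℝ × ℝ) : ContDiff ℝ 2 (proj2 f11 f12 f22 w) := by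
  unfold proj2
  fun_prop

lemma vanishesAbove_proj2 (h11 : VanishesAbove f11) (h12 : VanishesAbove f12)
    (h22 : VanishesAbove f22) (w : ℝ × ℝ) : VanishesAbove (proj2 f11 f12 f22 w) := by
  intro y hy
  simp [proj2, h11 y hy, h12 y hy, h22 y hy]

lemma proj2_add_proj2_perp {w : ℝ × ℝ} (hw : w.1 ^ 2 + w.2 ^ 2 = 1) :
    proj2 f11 f12 f22 w + proj2 f11 f12 f22 (perp w) = f11 + f22 := by
  funext y
  simp only [proj2, perp, Pi.add_apply]
  linear_combination (f11 y + f22 y) * hw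

/-- The sum of the longitudinal and transverse transforms is the V-line transform of the trace. -/
lemma Lf_add_Tf {u v : ℝ × ℝ} (hu : 0 < u.2) (hv : 0 < v.2) (hu1 : u.1 ^ 2 + u.2 ^ 2 = 1)
    (hv1 : v.1 ^ 2 + v.2 ^ 2 = 1) (hf11 : ContDiff ℝ 2 f11) (hf12 : ContDiff ℝ 2 f12)
    (hf22 : ContDiff ℝ 2 f22) (h11 : VanishesAbove f11) (h12 : VanishesAbove f12)
    (h22 : VanishesAbove f22) :
    (fun y => Lf u v f11 f12 f22 y + Tf u v f11 f12 f22 y) = Vlt u v (f11 + f22) := by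
  have hc := fun w => (contDiff_proj2 hf11 hf12 hf22 w).continuous
  have hz := vanishesAbove_proj2 h11 h12 h22
  funext y
  have eu := congrFun ((hz u).Xray_add (hz (perp u)) hu (hc u) (hc (perp u))) y
  have ev := congrFun ((hz v).Xray_add (hz (perp v)) hv (hc v) (hc (perp v))) y
  rw [proj2_add_proj2_perp hu1, Pi.add_apply] at eu
  rw [proj2_add_proj2_perp hv1, Pi.add_apply] at ev
  rw [Lf, Tf, Vlt, eu, ev]
  ring

end Proj2

theorem stmt_15 (u1 u2 : ℝ) (hu1 : 0 < u1) (hu2 : 0 < u2) (huv : u1 ^ 2 + u2 ^ 2 = 1)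
    (f11 f12 f22 : ℝ × ℝ → ℝ)
    (hf11 : ContDiff ℝ 2 f11) (hf12 : ContDiff ℝ 2 f12) (hf22 : ContDiff ℝ 2 f22)
    (hs11 : tsupport f11 ⊆ unitDisk) (hs12 : tsupport f12 ⊆ unitDisk)
    (hs22 : tsupport f22 ⊆ unitDisk)
    (hune : u1 ≠ u2) :
    ∀ x : ℝ × ℝ,
      f11 x =
        (1 / (2 * (u2 ^ 2 - u1 ^ 2))) *
          (Dw (u1, u2) (Dw (-u1, u2) (L1f (u1, u2) (-u1, u2) f11 f12 f22)) x +
            Dw (u1, u2) (Lf (u1, u2) (-u1, u2) f11 f12 f22) x + Dw (-u1, u2) (Lf (u1, u2) (-u1, u2) f11 f12 f22) x +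
            u2 * Dw (u1, u2) (Dw (-u1, u2) (Xray (0, 1) (fun y => Lf (u1, u2) (-u1, u2) f11 f12 f22 y + Tf (u1, u2) (-u1, u2) f11 f12 f22 y))) x) := by
  intro x
  have h11 := vanishesAbove_of_tsupport_subset hs11
  have h12 := vanishesAbove_of_tsupport_subset hs12
  have h22 := vanishesAbove_of_tsupport_subset hs22
  have hv1 : (-u1) ^ 2 + u2 ^ 2 = 1 := by rwa [neg_sq]
  have hz := vanishesAbove_proj2 h11 h12 h22
  have hc := contDiff_proj2 hf11 hf12 hf22
  have hL := congrFun (dw_dw_Xray1_add (u := (u1, u2)) (v := (-u1, u2)) hu2 hu2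
    (hc (u1, u2)) (hc (-u1, u2)) (hz _) (hz _)) x
  have hT := congrFun (dw_dw_Xray_Vlt (u := (u1, u2)) (v := (-u1, u2)) (e := (0, 1))
    (c := 2 * u2) hu2 hu2 one_pos (by ext <;> simp; ring) (g := f11 + f22) (hf11.add hf22)
    (fun y hy => by simp [h11 y hy, h22 y hy])) x
  rw [← Lf_add_Tf (u := (u1, u2)) (v := (-u1, u2)) hu2 hu2 huv hv1 hf11 hf12 hf22 h11 h12 h22]
    at hT
  simp only [Pi.add_apply, Pi.sub_apply, Pi.neg_apply, Pi.smul_apply, smul_eq_mul] at hL hT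
  have hne : u2 ^ 2 - u1 ^ 2 ≠ 0 := by
    rw [sq_sub_sq]
    exact mul_ne_zero (by positivity) (sub_ne_zero.2 hune.symm)
  rw [hT]
  change _ = _ * (Dw (u1, u2) (Dw (-u1, u2) (Xray1 _ _ + Xray1 _ _)) x
    + Dw (u1, u2) (Xray _ _ + Xray _ _) x + Dw (-u1, u2) (Xray _ _ + Xray _ _) x + _)
  rw [hL]
  simp only [proj2]
  field_simp
  ring
end
end

section
/- Let f = (f11,f12,f22) be a symmetric 2-tensor field with C² components compactly supported in the open unit disk. Then for every x ∈ ℝ², f22(x) = -(1/2)·{ D_u D_v (L¹f)(x) + D_u(Lf)(x) + D_v(Lf)(x) + (1/u2)·D_u D_v X_{-e1}[ (u1² - u2²)·V(f12) - Mf ](x) }, where X_{-e1} denotes the divergent beam transform in the direction -e1 and V(f12) = X_u f12 + X_v f12. -/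
open MeasureTheory

noncomputable section

open Filter Topology

section Beam

variable {E F : Type*} [NormedAddCommGroup E] [NormedSpace ℝ E] [NormedAddCommGroup F]

/-- Locally uniformly in the starting point, `h` vanishes far out along rays of direction `w`. -/
def VanishesAlong (w : E) (h : E → F) : Prop :=
  ∀ x₀, ∃ R : ℝ, 0 ≤ R ∧ ∀ᶠ x in 𝓝 x₀, ∀ t ≥ R, h (x + t • w) = 0

theorem HasCompactSupport.vanishesAlong {w : E} {h : E → F} (hs : HasCompactSupport h)
    (hw : w ≠ 0) : VanishesAlong w h := by
  intro x₀
  obtain ⟨r, hr⟩ := hs.isCompact.isBounded.exists_norm_le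
  have hw' : 0 < ‖w‖ := norm_pos_iff.2 hw
  refine ⟨(|r| + ‖x₀‖ + 2) / ‖w‖, by positivity, ?_⟩
  filter_upwards [Metric.ball_mem_nhds x₀ one_pos] with x hx t ht
  by_contra hne
  have h₁ := hr _ (subset_tsupport h hne)
  have h₂ : ‖x‖ < ‖x₀‖ + 1 := by
    have := norm_sub_norm_le x x₀
    rw [mem_ball_iff_norm] at hx
    linarith
  have h₃ : |r| + ‖x₀‖ + 2 ≤ t * ‖w‖ := (div_le_iff₀ hw').1 ht
  have h₄ : t * ‖w‖ ≤ ‖x + t • w‖ + ‖x‖ := by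
    have := norm_sub_le (x + t • w) x
    rw [add_sub_cancel_left, norm_smul, Real.norm_eq_abs] at this
    exact (mul_le_mul_of_nonneg_right (le_abs_self t) hw'.le).trans this
  linarith [le_abs_self r]

namespace VanishesAlong

variable {w : E} {h k : E → F}

theorem add (hh : VanishesAlong w h) (hk : VanishesAlong w k) :
    VanishesAlong w (fun x => h x + k x) := by
  intro x₀
  obtain ⟨R, hR, H⟩ := hh x₀
  obtain ⟨S, -, K⟩ := hk x₀
  refine ⟨max R S, le_max_of_le_left hR, ?_⟩
  filter_upwards [H, K] with x hx kx t ht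
  rw [hx t (le_of_max_le_left ht), kx t (le_of_max_le_right ht), add_zero]

theorem neg (hh : VanishesAlong w h) : VanishesAlong w (fun x => -h x) := by
  intro x₀
  obtain ⟨R, hR, H⟩ := hh x₀
  refine ⟨R, hR, ?_⟩
  filter_upwards [H] with x hx t ht
  rw [hx t ht, neg_zero]

theorem sub (hh : VanishesAlong w h) (hk : VanishesAlong w k) :
    VanishesAlong w (fun x => h x - k x) := by
  simpa only [sub_eq_add_neg] using hh.add hk.neg

end VanishesAlong

variable [NormedSpace ℝ F]

/-- The integral of `h` along the ray from `x` in direction `w`, with weight `φ`. -/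
def weightedBeam (φ : ℝ → ℝ) (w : E) (h : E → F) (x : E) : F :=
  ∫ t in Set.Ioi (0 : ℝ), φ t • h (x + t • w)

theorem weightedBeam_eq_intervalIntegral {φ : ℝ → ℝ} {w : E} {h : E → F} {x : E} {R : ℝ}
    (hR : 0 ≤ R) (hx : ∀ t ≥ R, h (x + t • w) = 0) :
    weightedBeam φ w h x = ∫ t in (0 : ℝ)..R, φ t • h (x + t • w) := by
  rw [weightedBeam, intervalIntegral.integral_of_le hR]
  refine setIntegral_eq_of_subset_of_forall_sdiff_eq_zero measurableSet_Ioi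
    Set.Ioc_subset_Ioi_self ?_
  rintro t ⟨ht, ht'⟩
  have : R ≤ t := by
    by_contra hlt
    exact ht' ⟨ht, (not_le.1 hlt).le⟩
  rw [hx t this, smul_zero]

theorem eventually_fderiv_eq_zero_along {w : E} {h : E → F} {x₀ : E} {R : ℝ}
    (H : ∀ᶠ x in 𝓝 x₀, ∀ t ≥ R, h (x + t • w) = 0) :
    ∀ᶠ x in 𝓝 x₀, ∀ t ≥ R, fderiv ℝ h (x + t • w) = 0 := by
  filter_upwards [eventually_eventually_nhds.2 H] with x hx t ht
  have hzero : h =ᶠ[𝓝 (x + t • w)] fun _ => 0 := by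
    have hc : Tendsto (fun y : E => y - t • w) (𝓝 (x + t • w)) (𝓝 x) := by
      have : ContinuousAt (fun y : E => y - t • w) (x + t • w) := by fun_prop
      simpa [ContinuousAt] using this
    filter_upwards [hc.eventually hx] with y hy
    simpa using hy t ht
  rw [hzero.fderiv_eq]
  simp

namespace VanishesAlong

variable {w : E} {h : E → F}

protected theorem fderiv (hh : VanishesAlong w h) : VanishesAlong w (fderiv ℝ h) := by
  intro x₀
  obtain ⟨R, hR, H⟩ := hh x₀
  exact ⟨R, hR, eventually_fderiv_eq_zero_along H⟩

theorem continuous_weightedBeam (hh : VanishesAlong w h) (hc : Continuous h)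
    {φ : ℝ → ℝ} (hφ : Continuous φ) : Continuous (weightedBeam φ w h) := by
  refine continuous_iff_continuousAt.2 fun x₀ => ?_
  obtain ⟨R, hR, H⟩ := hh x₀
  have H' : weightedBeam φ w h =ᶠ[𝓝 x₀] fun x => ∫ t in (0 : ℝ)..R, φ t • h (x + t • w) :=
    H.mono fun x => weightedBeam_eq_intervalIntegral hR
  refine ContinuousAt.congr (Continuous.continuousAt ?_) H'.symm
  exact intervalIntegral.continuous_parametric_intervalIntegral_of_continuous' (by fun_prop) 0 R

theorem integrableOn (hh : VanishesAlong w h) (hc : Continuous h) {φ : ℝ → ℝ}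
    (hφ : Continuous φ) (x : E) :
    IntegrableOn (fun t : ℝ => φ t • h (x + t • w)) (Set.Ioi 0) := by
  obtain ⟨R, hR, H⟩ := hh x
  have hI : IntegrableOn (fun t : ℝ => φ t • h (x + t • w)) (Set.Icc 0 R) :=
    Continuous.integrableOn_Icc (by fun_prop)
  refine hI.of_forall_sdiff_eq_zero measurableSet_Ioi ?_
  rintro t ⟨ht, ht'⟩
  have : R ≤ t := by
    by_contra hlt
    exact ht' ⟨le_of_lt ht, (not_le.1 hlt).le⟩
  rw [H.self_of_nhds t this, smul_zero]

theorem hasFDerivAt_weightedBeam [ProperSpace E] (hh : VanishesAlong w h)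
    (hc : ContDiff ℝ 1 h) {φ : ℝ → ℝ} (hφ : Continuous φ) (x₀ : E) :
    HasFDerivAt (weightedBeam φ w h) (weightedBeam φ w (fderiv ℝ h) x₀) x₀ := by
  obtain ⟨R, hR, H⟩ := hh x₀
  have hd : Continuous (fderiv ℝ h) := hc.continuous_fderiv one_ne_zero
  have hc' : Continuous h := hc.continuous
  have H' : weightedBeam φ w h =ᶠ[𝓝 x₀] fun x => ∫ t in (0 : ℝ)..R, φ t • h (x + t • w) :=
    H.mono fun x => weightedBeam_eq_intervalIntegral hR
  rw [weightedBeam_eq_intervalIntegral hR (eventually_fderiv_eq_zero_along H).self_of_nhds]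
  refine HasFDerivAt.congr_of_eventuallyEq ?_ H'
  have hK : IsCompact (Metric.closedBall x₀ 1 ×ˢ Set.Icc 0 R) :=
    (isCompact_closedBall x₀ 1).prod isCompact_Icc
  obtain ⟨C, hC⟩ := hK.exists_bound_of_continuousOn
    (f := fun p : E × ℝ => φ p.2 • fderiv ℝ h (p.1 + p.2 • w))
    (by fun_prop : Continuous _).continuousOn
  refine intervalIntegral.hasFDerivAt_integral_of_dominated_of_fderiv_le
    (F' := fun x t => φ t • fderiv ℝ h (x + t • w)) (bound := fun _ => C)
    (Metric.closedBall_mem_nhds x₀ one_pos)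
    (Eventually.of_forall fun x => Continuous.aestronglyMeasurable (by fun_prop))
    (Continuous.intervalIntegrable (by fun_prop) _ _)
    (Continuous.aestronglyMeasurable (by fun_prop))
    (Eventually.of_forall fun t ht x hx => ?_) intervalIntegrable_const
    (Eventually.of_forall fun t _ x _ => ?_)
  · rw [Set.uIoc_of_le hR] at ht
    exact hC (x, t) ⟨hx, ht.1.le, ht.2⟩
  · exact ((hasFDerivAt_comp_add_right (t • w)).2
      (hc.differentiable one_ne_zero _).hasFDerivAt).const_smul (φ t)

theorem contDiff_weightedBeam [ProperSpace E] (hh : VanishesAlong w h)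
    (hc : ContDiff ℝ 1 h) {φ : ℝ → ℝ} (hφ : Continuous φ) :
    ContDiff ℝ 1 (weightedBeam φ w h) := by
  refine contDiff_one_iff_hasFDerivAt.2 ⟨_, ?_, hh.hasFDerivAt_weightedBeam hc hφ⟩
  exact hh.fderiv.continuous_weightedBeam (hc.continuous_fderiv one_ne_zero) hφ

theorem fderiv_weightedBeam_apply [ProperSpace E] [CompleteSpace F] (hh : VanishesAlong w h)
    (hc : ContDiff ℝ 1 h) {φ : ℝ → ℝ} (hφ : Continuous φ) (x a : E) :
    fderiv ℝ (weightedBeam φ w h) x a = weightedBeam φ w (fun y => fderiv ℝ h y a) x := by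
  rw [(hh.hasFDerivAt_weightedBeam hc hφ x).fderiv, weightedBeam,
    ContinuousLinearMap.integral_apply
      (hh.fderiv.integrableOn (hc.continuous_fderiv one_ne_zero) hφ x)]
  rfl

/-- Integration by parts along a ray. -/
theorem weightedBeam_fderiv_self [CompleteSpace F] (hh : VanishesAlong w h) (hc : ContDiff ℝ 1 h)
    {φ φ' : ℝ → ℝ} (hφ : ∀ t, HasDerivAt φ (φ' t) t) (hφ' : Continuous φ') (x : E) :
    weightedBeam φ w (fun y => fderiv ℝ h y w) x = -(φ 0 • h x) - weightedBeam φ' w h x := by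
  obtain ⟨R, hR, H⟩ := hh x
  have H₀ := H.self_of_nhds
  have hd : Continuous (fderiv ℝ h) := hc.continuous_fderiv one_ne_zero
  have hc' : Continuous h := hc.continuous
  have hφc : Continuous φ := continuous_iff_continuousAt.2 fun t => (hφ t).continuousAt
  rw [weightedBeam_eq_intervalIntegral hR H₀, weightedBeam_eq_intervalIntegral hR fun t ht => by
    rw [(eventually_fderiv_eq_zero_along H).self_of_nhds t ht]; rfl]
  rw [intervalIntegral.integral_smul_deriv_eq_deriv_smul (u := φ) (u' := φ')
    (v := fun t => h (x + t • w)) (fun t _ => hφ t) (fun t _ => ?_)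
    (hφ'.intervalIntegrable _ _) (Continuous.intervalIntegrable (by fun_prop) _ _)]
  · simp [H₀ R le_rfl]
  · have hl : HasDerivAt (fun t : ℝ => x + t • w) w t := by
      simpa using ((hasDerivAt_id t).smul_const w).const_add x
    exact (hc.differentiable one_ne_zero _).hasFDerivAt.comp_hasDerivAt t hl

end VanishesAlong

end Beam

theorem Xray_eq_weightedBeam (w : ℝ × ℝ) (h : ℝ × ℝ → ℝ) :
    Xray w h = weightedBeam (fun _ => 1) w h := by
  funext x
  simp [Xray, weightedBeam]

theorem Xray1_eq_weightedBeam (w : ℝ × ℝ) (h : ℝ × ℝ → ℝ) :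
    Xray1 w h = weightedBeam id w h := rfl

section DirectionalDerivative

variable {h k : ℝ × ℝ → ℝ}

theorem Dw_add_s18 (hh : ContDiff ℝ 1 h) (hk : ContDiff ℝ 1 k) (a : ℝ × ℝ) :
    Dw a (fun x => h x + k x) = fun x => Dw a h x + Dw a k x := by
  funext x
  simp only [Dw]
  rw [fderiv_fun_add (hh.differentiable one_ne_zero x) (hk.differentiable one_ne_zero x)]
  rfl

theorem Dw_sub (hh : ContDiff ℝ 1 h) (hk : ContDiff ℝ 1 k) (a : ℝ × ℝ) :
    Dw a (fun x => h x - k x) = fun x => Dw a h x - Dw a k x := by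
  funext x
  simp only [Dw]
  rw [fderiv_fun_sub (hh.differentiable one_ne_zero x) (hk.differentiable one_ne_zero x)]
  rfl

theorem contDiff_Dw_s18 (hh : ContDiff ℝ 2 h) (a : ℝ × ℝ) : ContDiff ℝ 1 (Dw a h) :=
  (hh.fderiv_right (m := 1) (by norm_num)).clm_apply contDiff_const

theorem HasCompactSupport.Dw (hs : HasCompactSupport h) (a : ℝ × ℝ) :
    HasCompactSupport (Dw a h) :=
  hs.fderiv_apply ℝ a

theorem Dw_sub_Dw (u v : ℝ × ℝ) (h : ℝ × ℝ → ℝ) (x : ℝ × ℝ) :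
    Dw u h x - Dw v h x = Dw (u - v) h x :=
  (map_sub (fderiv ℝ h x) u v).symm

theorem Dw_smul (c : ℝ) (w : ℝ × ℝ) (h : ℝ × ℝ → ℝ) (x : ℝ × ℝ) :
    Dw (c • w) h x = c * Dw w h x :=
  map_smul (fderiv ℝ h x) c w

end DirectionalDerivative

namespace VanishesAlong

variable {w : ℝ × ℝ} {h k : ℝ × ℝ → ℝ}

theorem Dw_Xray (hh : VanishesAlong w h) (hc : ContDiff ℝ 1 h) (a : ℝ × ℝ) :
    Dw a (Xray w h) = Xray w (Dw a h) := by
  funext x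
  rw [Xray_eq_weightedBeam, Xray_eq_weightedBeam]
  exact hh.fderiv_weightedBeam_apply hc continuous_const x a

theorem Dw_Xray1 (hh : VanishesAlong w h) (hc : ContDiff ℝ 1 h) (a : ℝ × ℝ) :
    Dw a (Xray1 w h) = Xray1 w (Dw a h) :=
  funext fun x => hh.fderiv_weightedBeam_apply hc continuous_id x a

theorem contDiff_Xray (hh : VanishesAlong w h) (hc : ContDiff ℝ 1 h) :
    ContDiff ℝ 1 (Xray w h) := by
  rw [Xray_eq_weightedBeam]
  exact hh.contDiff_weightedBeam hc continuous_const

theorem contDiff_Xray1 (hh : VanishesAlong w h) (hc : ContDiff ℝ 1 h) :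
    ContDiff ℝ 1 (Xray1 w h) :=
  hh.contDiff_weightedBeam hc continuous_id

theorem Xray_Dw_self (hh : VanishesAlong w h) (hc : ContDiff ℝ 1 h) :
    Xray w (Dw w h) = fun x => -h x := by
  funext x
  rw [Xray_eq_weightedBeam]
  refine (hh.weightedBeam_fderiv_self hc (fun t => hasDerivAt_const t 1) continuous_const x).trans ?_
  simp [weightedBeam]

theorem Xray1_Dw_self (hh : VanishesAlong w h) (hc : ContDiff ℝ 1 h) :
    Xray1 w (Dw w h) = fun x => -Xray w h x := by
  funext x
  rw [Xray_eq_weightedBeam, Xray1_eq_weightedBeam]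
  refine (hh.weightedBeam_fderiv_self hc (fun t => hasDerivAt_id t) continuous_const x).trans ?_
  simp

theorem Xray_sub (hh : VanishesAlong w h) (hk : VanishesAlong w k) (hhc : Continuous h)
    (hkc : Continuous k) (x : ℝ × ℝ) :
    Xray w (fun y => h y - k y) x = Xray w h x - Xray w k x := by
  have Ih := hh.integrableOn hhc (φ := fun _ => 1) continuous_const x
  have Ik := hk.integrableOn hkc (φ := fun _ => 1) continuous_const x
  simp only [one_smul] at Ih Ik
  exact integral_sub Ih Ik

end VanishesAlong

theorem Xray_const_mul (w : ℝ × ℝ) (c : ℝ) (h : ℝ × ℝ → ℝ) (x : ℝ × ℝ) :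
    Xray w (fun y => c * h y) x = c * Xray w h x :=
  integral_const_mul _ _

/-- The beam transform of a compactly supported function in an upward direction vanishes
far out along horizontal rays. -/
theorem HasCompactSupport.vanishesAlong_Xray {w : ℝ × ℝ} {h : ℝ × ℝ → ℝ}
    (hs : HasCompactSupport h) (hw : 0 < w.2) : VanishesAlong (-1, 0) (Xray w h) := by
  intro x₀
  obtain ⟨r₀, hr₀⟩ := hs.isCompact.isBounded.exists_norm_le
  set r := |r₀|
  have hr : ∀ y ∈ tsupport h, ‖y‖ ≤ r := fun y hy => (hr₀ y hy).trans (le_abs_self r₀)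
  have hrn : 0 ≤ r := abs_nonneg r₀
  set M := ‖x₀‖ + 1
  have hM : 0 ≤ M := by positivity
  refine ⟨r + M + (r + M) / w.2 * |w.1| + 1, by positivity, ?_⟩
  filter_upwards [Metric.ball_mem_nhds x₀ one_pos] with x hx t ht
  have hxM : ‖x‖ ≤ M := by
    have := norm_sub_norm_le x x₀
    rw [mem_ball_iff_norm] at hx
    linarith
  refine setIntegral_eq_zero_of_forall_eq_zero fun s hs' => ?_
  by_contra hne
  have hb := hr _ (subset_tsupport h hne)
  have h₁ := abs_le.1 ((norm_fst_le _).trans hb)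
  have h₂ := abs_le.1 ((norm_snd_le _).trans hb)
  have hx₁ := abs_le.1 ((norm_fst_le x).trans hxM)
  have hx₂ := abs_le.1 ((norm_snd_le x).trans hxM)
  simp only [Prod.fst_add, Prod.snd_add, Prod.smul_fst, Prod.smul_snd, smul_eq_mul, mul_zero,
    add_zero, mul_neg, mul_one] at h₁ h₂
  have hs₀ : 0 < s := hs'
  have hsb : s ≤ (r + M) / w.2 := (le_div_iff₀ hw).2 (by linarith)
  have hsw : s * w.1 ≤ (r + M) / w.2 * |w.1| :=
    (mul_le_mul_of_nonneg_left (le_abs_self _) hs₀.le).trans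
      (mul_le_mul_of_nonneg_right hsb (abs_nonneg _))
  linarith

theorem hasCompactSupport_of_tsupport_subset_unitDisk {h : ℝ × ℝ → ℝ}
    (hs : tsupport h ⊆ unitDisk) : HasCompactSupport h := by
  refine (isCompact_closedBall (0 : ℝ × ℝ) 1).of_isClosed_subset (isClosed_tsupport h) ?_
  intro y hy
  have hy' : y.1 ^ 2 + y.2 ^ 2 < 1 := hs hy
  rw [mem_closedBall_zero_iff, Prod.norm_def, max_le_iff]
  exact ⟨abs_le_one_iff_mul_self_le_one.2 (by nlinarith),
    abs_le_one_iff_mul_self_le_one.2 (by nlinarith)⟩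

theorem stmt_18 (u1 u2 : ℝ) (hu1 : 0 < u1) (hu2 : 0 < u2) (huv : u1 ^ 2 + u2 ^ 2 = 1)
    (f11 f12 f22 : ℝ × ℝ → ℝ)
    (hf11 : ContDiff ℝ 2 f11) (hf12 : ContDiff ℝ 2 f12) (hf22 : ContDiff ℝ 2 f22)
    (hs11 : tsupport f11 ⊆ unitDisk) (hs12 : tsupport f12 ⊆ unitDisk)
    (hs22 : tsupport f22 ⊆ unitDisk) :
    ∀ x : ℝ × ℝ,
      f22 x =
        -(1 / 2) *
          (Dw (u1, u2) (Dw (-u1, u2) (L1f (u1, u2) (-u1, u2) f11 f12 f22)) x +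
            Dw (u1, u2) (Lf (u1, u2) (-u1, u2) f11 f12 f22) x + Dw (-u1, u2) (Lf (u1, u2) (-u1, u2) f11 f12 f22) x +
            (1 / u2) * Dw (u1, u2) (Dw (-u1, u2) (Xray (-1, 0) (fun y =>
              (u1 ^ 2 - u2 ^ 2) * (Xray (u1, u2) f12 y + Xray (-u1, u2) f12 y) -
                Mf (u1, u2) (-u1, u2) f11 f12 f22 y))) x) := by
  intro x
  have hk11 := hasCompactSupport_of_tsupport_subset_unitDisk hs11
  have hk12 := hasCompactSupport_of_tsupport_subset_unitDisk hs12
  have hk22 := hasCompactSupport_of_tsupport_subset_unitDisk hs22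
  set u : ℝ × ℝ := (u1, u2) with hu
  set v : ℝ × ℝ := (-u1, u2) with hv
  set e : ℝ × ℝ := (-1, 0) with he
  have hu0 : u ≠ 0 := fun h => hu2.ne' (congrArg Prod.snd h)
  have hv0 : v ≠ 0 := fun h => hu2.ne' (congrArg Prod.snd h)
  have he0 : e ≠ 0 := fun h => by simpa [he] using congrArg Prod.fst h
  have hproj : ∀ w, ContDiff ℝ 2 (proj2 f11 f12 f22 w) ∧
      HasCompactSupport (proj2 f11 f12 f22 w) := fun w =>
    ⟨by unfold proj2; fun_prop,
      (hk11.mul_right.add ((hk12.mul_left.mul_right).mul_right)).add hk22.mul_right⟩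
  have hmix : ∀ w, Continuous (projMix f11 f12 f22 w) ∧
      HasCompactSupport (projMix f11 f12 f22 w) := fun w =>
    ⟨by
      have := hf11.continuous
      have := hf12.continuous
      have := hf22.continuous
      unfold projMix; fun_prop,
      ((hk11.neg.mul_right.mul_right).add hk12.mul_right).add (hk22.mul_right.mul_right)⟩
  obtain ⟨hp2, hps⟩ := hproj u
  obtain ⟨hq2, hqs⟩ := hproj v
  set p := proj2 f11 f12 f22 u with hp
  set q := proj2 f11 f12 f22 v with hq
  have hp1 : ContDiff ℝ 1 p := hp2.of_le (by norm_num)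
  have hq1 : ContDiff ℝ 1 q := hq2.of_le (by norm_num)
  have hpu := hps.vanishesAlong hu0
  have hqv := hqs.vanishesAlong hv0
  have hDp := (hps.Dw v).vanishesAlong hu0
  have hDL1 : Dw v (L1f u v f11 f12 f22) = fun y => Xray1 u (Dw v p) y - Xray v q y := by
    change Dw v (fun y => Xray1 u p y + Xray1 v q y) = _
    rw [Dw_add_s18 (hpu.contDiff_Xray1 hp1) (hqv.contDiff_Xray1 hq1), hpu.Dw_Xray1 hp1,
      hqv.Dw_Xray1 hq1, hqv.Xray1_Dw_self hq1]
    rfl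
  have hDDL1 : Dw u (Dw v (L1f u v f11 f12 f22)) x
      = -Xray u (Dw v p) x - Xray v (Dw u q) x := by
    rw [hDL1, Dw_sub (hDp.contDiff_Xray1 (contDiff_Dw_s18 hp2 v)) (hqv.contDiff_Xray hq1),
      hDp.Dw_Xray1 (contDiff_Dw_s18 hp2 v), hDp.Xray1_Dw_self (contDiff_Dw_s18 hp2 v), hqv.Dw_Xray hq1]
  have hDL : ∀ a, Dw a (Lf u v f11 f12 f22) x = Xray u (Dw a p) x + Xray v (Dw a q) x := by
    intro a
    change Dw a (fun y => Xray u p y + Xray v q y) x = _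
    rw [Dw_add_s18 (hpu.contDiff_Xray hp1) (hqv.contDiff_Xray hq1), hpu.Dw_Xray hp1,
      hqv.Dw_Xray hq1]
  have hDLu : Dw u (Lf u v f11 f12 f22) x = -p x + Xray v (Dw u q) x := by
    rw [hDL, hpu.Xray_Dw_self hp1]
  have hDLv : Dw v (Lf u v f11 f12 f22) x = Xray u (Dw v p) x - q x := by
    rw [hDL, hqv.Xray_Dw_self hq1, sub_eq_add_neg]
  let g : ℝ × ℝ → ℝ := fun y => f11 y - f22 y
  have hg2 : ContDiff ℝ 2 g := hf11.sub hf22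
  have hgs : HasCompactSupport g := hk11.sub hk22
  let G : ℝ × ℝ → ℝ := fun y => u1 * u2 * g y
  have hG2 : ContDiff ℝ 2 G := contDiff_const.mul hg2
  have hG1 : ContDiff ℝ 1 G := hG2.of_le (by norm_num)
  have hGs : HasCompactSupport G := hgs.mul_left
  have hc12 : Continuous fun y => (u1 ^ 2 - u2 ^ 2) * f12 y := by
    have := hf12.continuous
    fun_prop
  have hs12' : HasCompactSupport fun y => (u1 ^ 2 - u2 ^ 2) * f12 y := hk12.mul_left
  have hbranch : ∀ w ≠ 0, ∀ y, (u1 ^ 2 - u2 ^ 2) * Xray w f12 y - Xray w (projMix f11 f12 f22 w) y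
      = Xray w (fun z => (u1 ^ 2 - u2 ^ 2) * f12 z - projMix f11 f12 f22 w z) y := by
    intro w hw y
    rw [(hs12'.vanishesAlong hw).Xray_sub ((hmix w).2.vanishesAlong hw) hc12 (hmix w).1,
      Xray_const_mul]
  have hbu : ∀ y, (u1 ^ 2 - u2 ^ 2) * Xray u f12 y - Xray u (projMix f11 f12 f22 u) y
      = Xray u G y := by
    intro y
    rw [hbranch u hu0]
    congr 1
    funext z
    simp only [projMix, G, g, hu]
    ring
  have hbv : ∀ y, (u1 ^ 2 - u2 ^ 2) * Xray v f12 y - Xray v (projMix f11 f12 f22 v) y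
      = -Xray v G y := by
    intro y
    rw [hbranch v hv0, neg_eq_neg_one_mul, ← Xray_const_mul]
    congr 1
    funext z
    simp only [projMix, G, g, hv]
    ring
  have hmixed : (fun y => (u1 ^ 2 - u2 ^ 2) * (Xray u f12 y + Xray v f12 y)
      - Mf u v f11 f12 f22 y) = fun y => Xray u G y - Xray v G y := by
    funext y
    rw [Mf]
    linarith [hbu y, hbv y]
  have hGu := hGs.vanishesAlong hu0
  have hGv := hGs.vanishesAlong hv0
  have hGe := hGs.vanishesAlong he0
  have hDG1 := contDiff_Dw_s18 hG2 v
  have hDGs := hGs.Dw v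
  have hDGu := hDGs.vanishesAlong hu0
  have hXGe : VanishesAlong e (fun y => Xray u G y - Xray v G y) :=
    (hGs.vanishesAlong_Xray hu2).sub (hGs.vanishesAlong_Xray hu2)
  have hDv : Dw v (Xray e fun y => Xray u G y - Xray v G y)
      = Xray e fun y => Xray u (Dw v G) y + G y := by
    rw [hXGe.Dw_Xray ((hGu.contDiff_Xray hG1).sub (hGv.contDiff_Xray hG1)),
      Dw_sub (hGu.contDiff_Xray hG1) (hGv.contDiff_Xray hG1), hGu.Dw_Xray hG1, hGv.Dw_Xray hG1,
      hGv.Xray_Dw_self hG1]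
    simp only [sub_neg_eq_add]
  have hXDGe : VanishesAlong e (fun y => Xray u (Dw v G) y + G y) :=
    (hDGs.vanishesAlong_Xray hu2).add hGe
  have huv_e : u - v = (-(2 * u1)) • e := by
    ext
    · simp [hu, hv, he]; ring
    · simp [hu, hv, he]
  have hDu : Dw u (Dw v (Xray e fun y => Xray u G y - Xray v G y)) x = 2 * u1 * G x := by
    rw [hDv, hXDGe.Dw_Xray ((hDGu.contDiff_Xray hDG1).add hG1),
      Dw_add_s18 (hDGu.contDiff_Xray hDG1) hG1, hDGu.Dw_Xray hDG1, hDGu.Xray_Dw_self hDG1]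
    simp only [neg_add_eq_sub, Dw_sub_Dw, huv_e, Dw_smul]
    rw [Xray_const_mul, hGe.Xray_Dw_self hG1]
    ring
  rw [hmixed, hDDL1, hDLu, hDLv, hDu]
  simp only [hp, hq, proj2, hu, hv, G, g]
  field_simp
  linear_combination (-2 * f22 x) * huv
end
end
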